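/- arXiv:2008.13181 — 3 statements merged into one kernel-verified Lean document; each statement's English description precedes it below -/
import Mathlib

section
/- Let A be a finite Heyting algebra projective in HA. Then there exist n ≥ 1 and elements ⊥ = c_0 < c_1 < ⋯ < c_n = ⊤ of A, each of which is a node of A, such that: every element of A lies in the closed interval [c_i, c_{i+1}] for some i < n; for each i < n, the interval [c_i, c_{i+1}] either has exactly two elements, or has exactly four elements and its two elements distinct from c_i and c_{i+1} are incomparable; and the top interval [c_{n-1}, c_n] has exactly two elements. -/
/-- `A` is projective in the class HA of all Heyting algebras. -/
def HeytingProjective (A : Type) [HeytingAlgebra A] : Prop :=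
  ∀ (B C : Type) [HeytingAlgebra B] [HeytingAlgebra C],
    ∀ (h : HeytingHom A C) (g : HeytingHom B C), Function.Surjective g →
      ∃ f : HeytingHom A B, ∀ a : A, g (f a) = h a

/-- A decomposition of a Heyting algebra by a chain of nodes
`⊥ = c 0 < c 1 < ⋯ < c n = ⊤`, where each interval `[c i, c (i+1)]` is a copy
of `2` or of `4` (the latter with two incomparable middle elements), every
element lies in some such interval, and the topmost interval is a copy of `2`. -/
def NodeChain (A : Type) [HeytingAlgebra A] (n : ℕ) (c : ℕ → A) : Prop :=
  c 0 = ⊥ ∧ c n = ⊤ ∧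
  (∀ i < n, c i < c (i + 1)) ∧
  (∀ i ≤ n, ∀ b : A, b ≤ c i ∨ c i ≤ b) ∧
  (∀ a : A, ∃ i < n, a ∈ Set.Icc (c i) (c (i + 1))) ∧
  (∀ i < n,
    (Set.Icc (c i) (c (i + 1))).ncard = 2 ∨
      ((Set.Icc (c i) (c (i + 1))).ncard = 4 ∧
        ∀ x ∈ Set.Icc (c i) (c (i + 1)), ∀ y ∈ Set.Icc (c i) (c (i + 1)),
          x ≠ c i → x ≠ c (i + 1) → y ≠ c i → y ≠ c (i + 1) → x ≠ y →
            ¬x ≤ y ∧ ¬y ≤ x)) ∧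
  (Set.Icc (c (n - 1)) (c n)).ncard = 2

/-- Extension of `A` by one new point of the dual poset, sitting over the upset `u`. -/
def PtExt (A : Type) [HeytingAlgebra A] (u : A) : Type :=
  {p : A × Prop // p.2 → u ≤ p.1}

instance PtExt.instPO (A : Type) [HeytingAlgebra A] (u : A) : PartialOrder (PtExt A u) :=
  inferInstanceAs (PartialOrder {p : A × Prop // p.2 → u ≤ p.1})

theorem PtExt.le_def {A : Type} [HeytingAlgebra A] {u : A} (x y : PtExt A u) :
    x ≤ y ↔ x.1.1 ≤ y.1.1 ∧ (x.1.2 → y.1.2) := Iff.rfl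

instance PtExt.instHA (A : Type) [HeytingAlgebra A] (u : A) : HeytingAlgebra (PtExt A u) where
  sup x y := ⟨(x.1.1 ⊔ y.1.1, x.1.2 ∨ y.1.2), by
    rintro (h | h)
    · exact (x.2 h).trans le_sup_left
    · exact (y.2 h).trans le_sup_right⟩
  le_sup_left x y := ⟨le_sup_left, Or.inl⟩
  le_sup_right x y := ⟨le_sup_right, Or.inr⟩
  sup_le x y z h1 h2 := ⟨sup_le h1.1 h2.1, fun h => h.elim h1.2 h2.2⟩
  inf x y := ⟨(x.1.1 ⊓ y.1.1, x.1.2 ∧ y.1.2), fun h => le_inf (x.2 h.1) (y.2 h.2)⟩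
  inf_le_left x y := ⟨inf_le_left, And.left⟩
  inf_le_right x y := ⟨inf_le_right, And.right⟩
  le_inf x y z h1 h2 := ⟨le_inf h1.1 h2.1, fun h => ⟨h1.2 h, h2.2 h⟩⟩
  top := ⟨(⊤, True), fun _ => le_top⟩
  le_top x := ⟨le_top, fun _ => trivial⟩
  bot := ⟨(⊥, False), fun h => h.elim⟩
  bot_le x := ⟨bot_le, fun h => h.elim⟩
  himp x y := ⟨(x.1.1 ⇨ y.1.1, (x.1.2 → y.1.2) ∧ u ≤ x.1.1 ⇨ y.1.1), fun h => h.2⟩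
  le_himp_iff x y z := by
    constructor
    · rintro ⟨h1, h2⟩
      exact ⟨le_himp_iff.1 h1, fun h => (h2 h.1).1 h.2⟩
    · rintro ⟨h1, h2⟩
      exact ⟨le_himp_iff.2 h1, fun h => ⟨fun h' => h2 ⟨h, h'⟩, (x.2 h).trans (le_himp_iff.2 h1)⟩⟩
  compl x := ⟨(x.1.1 ⇨ ⊥, (x.1.2 → False) ∧ u ≤ x.1.1 ⇨ ⊥), fun h => h.2⟩
  himp_bot x := rfl

/-- The projection `PtExt A u → A`. -/
def PtExt.proj (A : Type) [HeytingAlgebra A] (u : A) : HeytingHom (PtExt A u) A where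
  toFun x := x.1.1
  map_sup' _ _ := rfl
  map_inf' _ _ := rfl
  map_bot' := rfl
  map_himp' _ _ := rfl

/-- Weak join-primeness. -/
def JPr {A : Type} [HeytingAlgebra A] (j : A) : Prop := ∀ a b : A, j ≤ a ⊔ b → j ≤ a ∨ j ≤ b

theorem exists_cover {A : Type} [HeytingAlgebra A] [Finite A] (hproj : HeytingProjective A)
    (u : A) : ∃ j : A, j ≠ ⊥ ∧ JPr j ∧ u ≤ j ∧ ∀ a, j ≤ a ∨ a ⊓ j ≤ u := by
  obtain ⟨f, hf⟩ := hproj (PtExt A u) A (HeytingHom.id A) (PtExt.proj A u)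
    (fun a => ⟨⟨(a, False), fun h => h.elim⟩, rfl⟩)
  have hf1 : ∀ a, (f a).1.1 = a := hf
  have hmono : ∀ a b, a ≤ b → (f a).1.2 → (f b).1.2 := fun a b h =>
    ((PtExt.le_def _ _).1 (OrderHomClass.mono f h)).2
  have htop : (f ⊤).1.2 := by rw [map_top]; trivial
  have hbot : ¬ (f ⊥).1.2 := by rw [map_bot]; exact id
  have hinf : ∀ a b, (f a).1.2 → (f b).1.2 → (f (a ⊓ b)).1.2 := by
    intro a b ha hb
    rw [map_inf]; exact ⟨ha, hb⟩
  have hsup : ∀ a b, (f (a ⊔ b)).1.2 → (f a).1.2 ∨ (f b).1.2 := by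
    intro a b h
    rw [map_sup] at h; exact h
  have himp : ∀ a b, ((f a).1.2 → (f b).1.2) → u ≤ a ⇨ b → (f (a ⇨ b)).1.2 := by
    intro a b h h'
    rw [map_himp]
    refine ⟨h, ?_⟩
    rw [hf1, hf1]; exact h'
  obtain ⟨j, hj, hmin⟩ := (wellFounded_lt (α := A)).has_min {a | (f a).1.2} ⟨⊤, htop⟩
  have hle : ∀ a, (f a).1.2 → j ≤ a := by
    intro a ha
    by_contra hja
    exact hmin (j ⊓ a) (hinf _ _ hj ha) (inf_lt_left.2 hja)
  refine ⟨j, ?_, ?_, ?_, ?_⟩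
  · rintro rfl; exact hbot hj
  · intro a b h
    rcases hsup a b (hmono _ _ h hj) with h | h
    · exact Or.inl (hle _ h)
    · exact Or.inr (hle _ h)
  · have := (f j).2 hj
    rwa [hf1] at this
  · intro a
    by_cases ha : j ≤ a
    · exact Or.inl ha
    · right
      have := hle _ (himp a u (fun h => (ha (hle _ h)).elim) (le_himp_iff.2 inf_le_left))
      rw [inf_comm]
      exact le_himp_iff.1 this

theorem exists_prime {A : Type} [HeytingAlgebra A] [Finite A] {x y : A} (h : ¬ x ≤ y) :
    ∃ p, JPr p ∧ p ≤ x ∧ ¬ p ≤ y := by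
  obtain ⟨p, hp, hmin⟩ := (wellFounded_lt (α := A)).has_min {p | p ≤ x ∧ ¬ p ≤ y} ⟨x, le_rfl, h⟩
  refine ⟨p, ?_, hp⟩
  intro a b hab
  by_contra hcon
  push Not at hcon
  have key : ∀ a, ¬ p ≤ a → p ⊓ a ≤ y := by
    intro a ha
    by_contra h'
    exact hmin (p ⊓ a) ⟨inf_le_left.trans hp.1, h'⟩ (inf_lt_left.2 ha)
  apply hp.2
  calc p = p ⊓ (a ⊔ b) := (inf_eq_left.2 hab).symm
    _ = p ⊓ a ⊔ p ⊓ b := inf_sup_left _ _ _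
    _ ≤ y := sup_le (key a hcon.1) (key b hcon.2)

/-- `j` covers `u` in the strong sense given by projectivity. -/
def Cov {A : Type} [HeytingAlgebra A] (u j : A) : Prop :=
  JPr j ∧ u ≤ j ∧ ∀ a, j ≤ a ∨ a ⊓ j ≤ u

theorem Cov.le_of {A : Type} [HeytingAlgebra A] {u j c : A} (h : Cov u j) (hc : c ≤ j) :
    j ≤ c ∨ c ≤ u := by
  rcases h.2.2 c with h | h
  · exact Or.inl h
  · right; rwa [inf_eq_left.2 hc] at h

/-- Incomparability. -/
def Inc {A : Type} [HeytingAlgebra A] (a b : A) : Prop := ¬ a ≤ b ∧ ¬ b ≤ a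

theorem Inc.symm' {A : Type} [HeytingAlgebra A] {a b : A} (h : Inc a b) : Inc b a := ⟨h.2, h.1⟩

theorem anti_step {A : Type} [HeytingAlgebra A] {a b c j k : A} (hb : JPr b) (hc : JPr c)
    (hab : Inc a b) (hac : Inc a c) (hbc : Inc b c) (hj : Cov (a ⊔ b) j) (hk : Cov (a ⊔ c) k) :
    ¬ j ≤ k := by
  intro hjk
  rcases hk.le_of hjk with h | h
  · have hcj : c ≤ j := (le_sup_right.trans hk.2.1).trans h
    rcases hj.le_of hcj with h | h
    · exact hac.1 ((le_sup_left.trans hj.2.1).trans h)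
    · rcases hc _ _ h with h | h
      · exact hac.2 h
      · exact hbc.2 h
  · have hb' : b ≤ a ⊔ c := (le_sup_right.trans hj.2.1).trans h
    rcases hb _ _ hb' with h | h
    · exact hab.2 h
    · exact hbc.1 h

theorem no_anti {A : Type} [HeytingAlgebra A] [Finite A] (H : ∀ u : A, ∃ j, Cov u j) (m : A) :
    ∀ a b c : A, JPr a → JPr b → JPr c → Inc a b → Inc a c → Inc b c → m = a ⊔ b ⊔ c → False := by
  induction m using (wellFounded_gt (α := A)).induction with
  | _ m ih =>
  intro a b c ha hb hc hab hac hbc hm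
  obtain ⟨j, hj⟩ := H (a ⊔ b)
  obtain ⟨k, hk⟩ := H (a ⊔ c)
  obtain ⟨l, hl⟩ := H (b ⊔ c)
  have hj' : Cov (b ⊔ a) j := by rwa [sup_comm]
  have hk' : Cov (c ⊔ a) k := by rwa [sup_comm]
  have hl' : Cov (c ⊔ b) l := by rwa [sup_comm]
  have haj : a ≤ j := le_sup_left.trans hj.2.1
  have hbj : b ≤ j := le_sup_right.trans hj.2.1
  have hck : c ≤ k := le_sup_right.trans hk.2.1
  refine ih (j ⊔ k ⊔ l) ?_ j k l hj.1 hk.1 hl.1 ?_ ?_ ?_ rfl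
  · show m < _
    rw [hm]
    refine lt_of_le_not_ge ?_ ?_
    · exact sup_le (sup_le (haj.trans (le_sup_left.trans le_sup_left))
        (hbj.trans (le_sup_left.trans le_sup_left))) (hck.trans (le_sup_right.trans le_sup_left))
    · intro h
      have h1 : j ≤ a ⊔ b ⊔ c := (le_sup_left.trans le_sup_left).trans h
      rcases hj.1 _ _ h1 with h | h
      · rcases hj.1 _ _ h with h | h
        · exact hab.2 (hbj.trans h)
        · exact hab.1 (haj.trans h)
      · exact hac.1 (haj.trans h)
  · exact ⟨anti_step hb hc hab hac hbc hj hk, anti_step hc hb hac hab hbc.symm' hk hj⟩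
  · exact ⟨anti_step ha hc hab.symm' hbc hac hj' hl, anti_step hc ha hbc hab.symm' hac.symm' hl hj'⟩
  · exact ⟨anti_step ha hb hac.symm' hbc.symm' hab hk' hl',
      anti_step hb ha hbc.symm' hac.symm' hab.symm' hl' hk'⟩

theorem no_chain {A : Type} [HeytingAlgebra A] [Finite A] (H : ∀ u : A, ∃ j, Cov u j) (m : A) :
    ∀ a b c : A, JPr a → JPr b → JPr c → Inc a b → Inc a c → b < c → m = a ⊔ c → False := by
  induction m using (wellFounded_gt (α := A)).induction with
  | _ m ih =>
  intro a b c ha hb hc hab hac hbc hm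
  obtain ⟨j, hj⟩ := H (a ⊔ b)
  have haj : a ≤ j := le_sup_left.trans hj.2.1
  have hbj : b ≤ j := le_sup_right.trans hj.2.1
  have hjc : ¬ j ≤ c := fun h => hac.1 (haj.trans h)
  refine ih (c ⊔ j) ?_ c a j hc ha hj.1 hac.symm' ⟨?_, hjc⟩ ?_ rfl
  · show m < _
    rw [hm]
    refine lt_of_le_not_ge (sup_le (haj.trans le_sup_right) le_sup_left) ?_
    intro h
    rcases hj.1 _ _ (le_sup_right.trans h) with h | h
    · exact hab.2 (hbj.trans h)
    · exact hjc h
  · intro h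
    rcases hj.le_of h with h | h
    · exact hjc h
    · rcases hc _ _ h with h | h
      · exact hac.2 h
      · exact hbc.not_ge h
  · exact lt_of_le_not_ge haj fun h => hab.2 (hbj.trans h)

theorem prime_match {A : Type} [HeytingAlgebra A] [Finite A] (H : ∀ u : A, ∃ j, Cov u j)
    {a b c : A} (ha : JPr a) (hb : JPr b) (hc : JPr c) (hab : Inc a b) (hac : Inc a c) : b = c := by
  by_contra hne
  by_cases h1 : b ≤ c
  · exact no_chain H _ a b c ha hb hc hab hac (lt_of_le_of_ne h1 hne) rfl
  by_cases h2 : c ≤ b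
  · exact no_chain H _ a c b ha hc hb hac hab (lt_of_le_of_ne h2 (Ne.symm hne)) rfl
  exact no_anti H _ a b c ha hb hc hab hac ⟨h1, h2⟩ rfl

theorem prime_of_inc {A : Type} [HeytingAlgebra A] [Finite A] (H : ∀ u : A, ∃ j, Cov u j)
    {x y : A} (hxy : Inc x y) : JPr x := by
  intro s t hst
  by_contra hcon
  push Not at hcon
  obtain ⟨p, hp, hpx, hps⟩ := exists_prime hcon.1
  obtain ⟨q, hq, hqx, hqt⟩ := exists_prime hcon.2
  have hpt : p ≤ t := (hp _ _ (hpx.trans hst)).resolve_left hps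
  have hqs : q ≤ s := (hq _ _ (hqx.trans hst)).resolve_right hqt
  have hpq : Inc p q := ⟨fun h => hps (h.trans hqs), fun h => hqt (h.trans hpt)⟩
  obtain ⟨r, hr, hry, hrx⟩ := exists_prime hxy.2
  obtain ⟨p', hp', hpx', hpy'⟩ := exists_prime hxy.1
  have hpr : p ≤ r := by
    by_contra h
    have := prime_match H hp hq hr hpq ⟨h, fun h' => hrx (h'.trans hpx)⟩
    exact hrx (this ▸ hqx)
  have hqr : q ≤ r := by
    by_contra h
    have := prime_match H hq hp hr hpq.symm' ⟨h, fun h' => hrx (h'.trans hqx)⟩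
    exact hrx (this ▸ hpx)
  have hpr' : Inc p' r := ⟨fun h => hpy' (h.trans hry), fun h => hrx (h.trans hpx')⟩
  have h1 : p ≤ p' := by
    by_contra h
    have := prime_match H hp' hr hp hpr' ⟨fun h' => hpy' ((h'.trans hpr).trans hry), h⟩
    exact hrx (this ▸ hpx)
  have h2 : q ≤ p' := by
    by_contra h
    have := prime_match H hp' hr hq hpr' ⟨fun h' => hpy' ((h'.trans hqr).trans hry), h⟩
    exact hrx (this ▸ hqx)
  rcases hp' _ _ (hpx'.trans hst) with h | h
  · exact hps (h1.trans h)
  · exact hqt (h2.trans h)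

theorem inc_match {A : Type} [HeytingAlgebra A] [Finite A] (H : ∀ u : A, ∃ j, Cov u j)
    {a b c : A} (hab : Inc a b) (hac : Inc a c) : b = c :=
  prime_match H (prime_of_inc H hab) (prime_of_inc H hab.symm') (prime_of_inc H hac.symm') hab hac

/-- Nodes. -/
def IsNd {A : Type} [HeytingAlgebra A] (a : A) : Prop := ∀ b : A, b ≤ a ∨ a ≤ b

theorem node_inf {A : Type} [HeytingAlgebra A]
    (M : ∀ a b c : A, Inc a b → Inc a c → b = c) {x y : A} (h : Inc x y) : IsNd (x ⊓ y) := by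
  intro z
  by_contra hz
  push Not at hz
  have hxz : ¬ x ≤ z := fun h' => hz.2 (inf_le_left.trans h')
  have hyz : ¬ y ≤ z := fun h' => hz.2 (inf_le_right.trans h')
  by_cases h1 : z ≤ x
  · have h2 : ¬ z ≤ y := fun h' => hz.1 (le_inf h1 h')
    exact hxz (M y x z h.symm' ⟨hyz, h2⟩).le
  · exact hyz (M x y z h ⟨hxz, h1⟩).le

theorem node_sup {A : Type} [HeytingAlgebra A]
    (M : ∀ a b c : A, Inc a b → Inc a c → b = c) {x y : A} (h : Inc x y) : IsNd (x ⊔ y) := by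
  intro z
  by_contra hz
  push Not at hz
  have hxz : ¬ z ≤ x := fun h' => hz.1 (h'.trans le_sup_left)
  have hyz : ¬ z ≤ y := fun h' => hz.1 (h'.trans le_sup_right)
  by_cases h1 : x ≤ z
  · have h2 : ¬ y ≤ z := fun h' => hz.2 (sup_le h1 h')
    exact hxz (M y x z h.symm' ⟨h2, hyz⟩).ge
  · exact hyz (M x y z h ⟨h1, hxz⟩).ge

/-- Description of the interval between two consecutive nodes. -/
theorem interval {A : Type} [HeytingAlgebra A]
    (M : ∀ a b c : A, Inc a b → Inc a c → b = c) {c d : A} (hc : IsNd c) (hd : IsNd d)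
    (hcd : c < d) (hcons : ∀ e, IsNd e → c ≤ e → e ≤ d → e = c ∨ e = d) :
    Set.Icc c d = {c, d} ∨ ∃ x y, Inc x y ∧ c < x ∧ x < d ∧ c < y ∧ y < d ∧ x ⊔ y = d ∧
      Set.Icc c d = {c, d, x, y} := by
  by_cases hall : ∀ x ∈ Set.Icc c d, x = c ∨ x = d
  · left
    ext x
    constructor
    · intro hx; simpa using hall x hx
    · rintro (rfl | rfl)
      · exact ⟨le_rfl, hcd.le⟩
      · exact ⟨hcd.le, le_rfl⟩
  · right
    push Not at hall
    obtain ⟨x, ⟨hcx, hxd⟩, hxc', hxd'⟩ := hall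
    have hnx : ¬ IsNd x := fun h => by
      rcases hcons x h hcx hxd with h | h
      · exact hxc' h
      · exact hxd' h
    unfold IsNd at hnx
    push Not at hnx
    obtain ⟨y, hyx, hxy⟩ := hnx
    have hI : Inc x y := ⟨hxy, hyx⟩
    have hcy : c ≤ y := (hc y).resolve_left fun h => hyx (h.trans hcx)
    have hyd : y ≤ d := (hd y).resolve_right fun h => hxy (hxd.trans h)
    have hyc' : c ≠ y := fun h => hyx (h ▸ hcx)
    have hyd' : y ≠ d := fun h => hxy (h ▸ hxd)
    have hs : x ⊔ y = d := by
      rcases hcons _ (node_sup M hI) (hcx.trans le_sup_left) (sup_le hxd hyd) with h | h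
      · exact absurd (le_antisymm (h ▸ le_sup_left) hcx) hxc'
      · exact h
    have hi : x ⊓ y = c := by
      rcases hcons _ (node_inf M hI) (le_inf hcx hcy) (inf_le_left.trans hxd) with h | h
      · exact h
      · exact absurd (le_antisymm hxd (h ▸ inf_le_left)) hxd'
    refine ⟨x, y, hI, lt_of_le_of_ne hcx (Ne.symm hxc'), lt_of_le_of_ne hxd hxd',
      lt_of_le_of_ne hcy hyc', lt_of_le_of_ne hyd hyd', hs, ?_⟩
    ext z
    simp only [Set.mem_insert_iff, Set.mem_singleton_iff]
    constructor
    · rintro ⟨hcz, hzd⟩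
      by_contra hz
      push Not at hz
      obtain ⟨z1, z2, z3, z4⟩ := hz
      have n1 : ¬ Inc x z := fun h => z4 (M x z y h hI)
      have n2 : ¬ Inc y z := fun h => z3 (M y z x h hI.symm')
      unfold Inc at n1 n2
      by_cases a1 : x ≤ z
      · by_cases a2 : y ≤ z
        · exact z2 (le_antisymm hzd (hs ▸ sup_le a1 a2))
        · have : z ≤ y := by by_contra h; exact n2 ⟨a2, h⟩
          exact hxy (a1.trans this)
      · have a3 : z ≤ x := by by_contra h; exact n1 ⟨a1, h⟩
        by_cases a2 : y ≤ z
        · exact hyx (a2.trans a3)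
        · have : z ≤ y := by by_contra h; exact n2 ⟨a2, h⟩
          exact z1 (le_antisymm (hi ▸ le_inf a3 this) hcz)
    · rintro (rfl | rfl | rfl | rfl)
      · exact ⟨le_rfl, hcd.le⟩
      · exact ⟨hcd.le, le_rfl⟩
      · exact ⟨hcx, hxd⟩
      · exact ⟨hcy, hyd⟩

/-- The nodes listed in increasing order. -/
theorem exists_enum (A : Type) [HeytingAlgebra A] [Finite A] (hne : (⊥ : A) ≠ ⊤) :
    ∃ n ≥ 1, ∃ c : ℕ → A, c 0 = ⊥ ∧ c n = ⊤ ∧ (∀ i < n, c i < c (i + 1)) ∧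
      (∀ i, IsNd (c i)) ∧
      (∀ i < n, ∀ e, IsNd e → c i ≤ e → e ≤ c (i + 1) → e = c i ∨ e = c (i + 1)) := by
  classical
  let N := {a : A // IsNd a}
  letI : LinearOrder N :=
    { (inferInstance : PartialOrder N) with
      le_total := fun a b => b.2 a.1
      toDecidableLE := Classical.decRel _ }
  haveI : Fintype N := Fintype.ofFinite N
  have hbot : IsNd (⊥ : A) := fun b => Or.inr bot_le
  have htop : IsNd (⊤ : A) := fun b => Or.inl le_top
  have hcard : 1 < Fintype.card N :=
    Fintype.one_lt_card_iff.2 ⟨⟨⊥, hbot⟩, ⟨⊤, htop⟩, fun h => hne (congrArg Subtype.val h)⟩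
  obtain ⟨n, hn⟩ : ∃ n, Fintype.card N = n + 1 := ⟨Fintype.card N - 1, by omega⟩
  let e : Fin (n + 1) ≃o N := Fintype.orderIsoFinOfCardEq N hn
  have hlt : ∀ i, min i n < n + 1 := fun i => by omega
  refine ⟨n, by omega, fun i => (e ⟨min i n, hlt i⟩).1, ?_, ?_, ?_, ?_, ?_⟩
  · obtain ⟨k, hk⟩ := e.surjective ⟨⊥, hbot⟩
    have h : e ⟨min 0 n, hlt 0⟩ ≤ e k := e.monotone (by simp [Fin.le_def])
    rw [hk] at h
    exact le_bot_iff.1 h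
  · obtain ⟨k, hk⟩ := e.surjective ⟨⊤, htop⟩
    have h : e k ≤ e ⟨min n n, hlt n⟩ := e.monotone (by simp [Fin.le_def]; omega)
    rw [hk] at h
    exact top_le_iff.1 h
  · intro i hi
    have h : e ⟨min i n, hlt i⟩ < e ⟨min (i + 1) n, hlt (i + 1)⟩ :=
      e.strictMono (by simp only [Fin.mk_lt_mk]; omega)
    exact h
  · intro i
    exact (e _).2
  · intro i hi x hx h1 h2
    obtain ⟨k, hk⟩ := e.surjective ⟨x, hx⟩
    have h1' : e ⟨min i n, hlt i⟩ ≤ e k := by rw [hk]; exact h1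
    have h2' : e k ≤ e ⟨min (i + 1) n, hlt (i + 1)⟩ := by rw [hk]; exact h2
    rw [e.le_iff_le, Fin.le_def] at h1' h2'
    simp only at h1' h2'
    have hxk : x = (e k).1 := by rw [hk]
    by_cases hki : k.1 = i
    · left
      rw [hxk]
      congr 2
      apply Fin.ext
      simp only; omega
    · right
      rw [hxk]
      congr 2
      apply Fin.ext
      simp only; omega

/-- Every finite projective Heyting algebra decomposes as an ordinal sum of
copies of `2` and `4` with topmost summand `2`. -/
theorem finite_projective_Heyting_node_chain (A : Type) [HeytingAlgebra A]
    [Finite A] (hproj : HeytingProjective A) :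
    ∃ n ≥ 1, ∃ c : ℕ → A, NodeChain A n c := by
  have H : ∀ u : A, ∃ j, Cov u j := fun u => by
    obtain ⟨j, _, h⟩ := exists_cover hproj u
    exact ⟨j, h⟩
  have M : ∀ a b c : A, Inc a b → Inc a c → b = c := fun a b c => inc_match H
  obtain ⟨j, hjb, hjp, hjt, _⟩ := exists_cover hproj ⊤
  obtain rfl : j = ⊤ := top_le_iff.1 hjt
  obtain ⟨n, hn, c, h0, hn', hlt, hnd, hcons⟩ := exists_enum A hjb.symm
  have hint := fun i (hi : i < n) =>
    interval M (hnd i) (hnd (i + 1)) (hlt i hi) (hcons i hi)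
  refine ⟨n, hn, c, h0, hn', hlt, fun i _ => hnd i, ?_, ?_, ?_⟩
  · intro a
    by_contra hcon
    push Not at hcon
    have key : ∀ i ≤ n, c i ≤ a := by
      intro i
      induction i with
      | zero => intro _; rw [h0]; exact bot_le
      | succ i ih =>
        intro hi
        exact (hnd (i + 1) a).resolve_left fun h => hcon i hi ⟨ih (by omega), h⟩
    have hcn := key (n - 1) (by omega)
    refine hcon (n - 1) (by omega) ⟨hcn, ?_⟩
    rw [Nat.sub_add_cancel hn, hn']
    exact le_top
  · intro i hi
    rcases hint i hi with h | ⟨x, y, hI, h1, h2, h3, h4, h5, h⟩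
    · left
      rw [h]; exact Set.ncard_pair (hlt i hi).ne
    · right
      have hxy : x ≠ y := fun h => hI.1 h.le
      rw [h]
      refine ⟨?_, ?_⟩
      · rw [Set.ncard_insert_of_notMem, Set.ncard_insert_of_notMem, Set.ncard_pair hxy]
        · simp [h2.ne', h4.ne']
        · simp [(hlt i hi).ne, h1.ne, h3.ne]
      · rintro z (rfl | rfl | rfl | rfl) w (rfl | rfl | rfl | rfl) a1 a2 a3 a4 a5 <;>
          first
          | exact absurd rfl a1
          | exact absurd rfl a2
          | exact absurd rfl a3
          | exact absurd rfl a4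
          | exact absurd rfl a5
          | exact hI
          | exact hI.symm'
  · have hs : n - 1 + 1 = n := Nat.sub_add_cancel hn
    have hl := hlt (n - 1) (by omega)
    rcases hint (n - 1) (by omega) with h | ⟨x, y, hI, h1, h2, h3, h4, h5, h⟩
    · rw [hs] at h hl
      rw [h]; exact Set.ncard_pair hl.ne
    · exfalso
      rw [hs, hn'] at h2 h4 h5
      rcases hjp x y h5.ge with h | h
      · exact h2.not_ge h
      · exact h4.not_ge h
end

section
/- Let A and B be finite bounded hoops and g : B → A a surjective bounded hoop homomorphism such that g(x) = 0 implies x = 0. Then A is a retract of B: there exists a bounded hoop homomorphism h : A → B with g ∘ h = id_A. Consequently, every finite bounded hoop is zero-projective in the class of all finite bounded hoops. -/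
/-- A hoop: a commutative monoid `(α, ·, 1)` with an operation `→` satisfying
`x → x = 1`, divisibility `x·(x → y) = y·(y → x)`, and
`x → (y → z) = (x·y) → z`. -/
class Hoop (α : Type) where
  mul : α → α → α
  himp : α → α → α
  one : α
  mul_comm : ∀ a b : α, mul a b = mul b a
  mul_assoc : ∀ a b c : α, mul (mul a b) c = mul a (mul b c)
  mul_one : ∀ a : α, mul a one = a
  himp_self : ∀ a : α, himp a a = one
  div : ∀ a b : α, mul a (himp a b) = mul b (himp b a)
  himp_himp : ∀ a b c : α, himp a (himp b c) = himp (mul a b) c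

/-- A bounded hoop: a hoop with a least element `0` (i.e. `0 → x = 1`). -/
class BHoop (α : Type) extends Hoop α where
  zero : α
  zero_himp : ∀ a : α, himp zero a = one

/-- A bounded hoop homomorphism preserves `·`, `→`, `1` and `0`. -/
def IsBHoopHom {α β : Type} [BHoop α] [BHoop β] (f : α → β) : Prop :=
  (∀ a b : α, f (Hoop.mul a b) = Hoop.mul (f a) (f b)) ∧
  (∀ a b : α, f (Hoop.himp a b) = Hoop.himp (f a) (f b)) ∧
  f Hoop.one = Hoop.one ∧ f BHoop.zero = BHoop.zero

/-- Negation in a bounded hoop: `¬x = x → 0`. -/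
def BHoop.neg {α : Type} [BHoop α] (a : α) : α := Hoop.himp a BHoop.zero

namespace HoopAux
open Hoop

/-- The hoop order. -/
def le {α : Type} [Hoop α] (a b : α) : Prop := himp a b = (one : α)

variable {α : Type} [Hoop α]

theorem one_mul (a : α) : mul one a = a := by rw [Hoop.mul_comm, Hoop.mul_one]

theorem le_refl (a : α) : le a a := Hoop.himp_self a

theorem le_antisymm {a b : α} (h1 : le a b) (h2 : le b a) : a = b := by
  have := Hoop.div a b
  unfold le at h1 h2
  rwa [h1, h2, Hoop.mul_one, Hoop.mul_one] at this

theorem adj {a b c : α} : le (mul a b) c ↔ le a (himp b c) := by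
  unfold le; rw [Hoop.himp_himp]

theorem himp_one (a : α) : himp a one = (one : α) := by
  obtain ⟨t, ht⟩ : ∃ t, himp a (one : α) = t := ⟨_, rfl⟩
  have hs : himp one a = mul a t := by
    have := Hoop.div one a
    rwa [one_mul, ht] at this
  have h1t : himp one t = t := by rw [← ht, Hoop.himp_himp, one_mul]
  have htr : mul t (himp t one) = t := by
    rw [Hoop.div, one_mul, h1t]
  have h1 : himp a (himp one a) = (one : α) := by
    rw [Hoop.himp_himp, Hoop.mul_one, Hoop.himp_self]
  have hsa : himp (himp one a) a = himp t (one : α) := by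
    rw [hs, Hoop.mul_comm, ← Hoop.himp_himp, Hoop.himp_self]
  have hat : mul a t = a := by
    have := Hoop.div a (himp one a)
    rw [h1, Hoop.mul_one, hsa, hs, Hoop.mul_assoc, htr] at this
    exact this.symm
  calc himp a (one : α) = himp (mul t a) one := by rw [Hoop.mul_comm, hat]
    _ = himp t (himp a one) := by rw [Hoop.himp_himp]
    _ = one := by rw [ht, Hoop.himp_self]

theorem le_one (a : α) : le a one := himp_one a

theorem one_himp (a : α) : himp one a = a := by
  have := Hoop.div one a
  rwa [one_mul, himp_one, Hoop.mul_one] at this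

theorem mul_eq_of_le {a b : α} (h : le a b) : mul b (himp b a) = a := by
  unfold le at h
  rw [← Hoop.div, h, Hoop.mul_one]

theorem mul_le_left (a b : α) : le (mul a b) a := by
  unfold le
  rw [Hoop.mul_comm, ← Hoop.himp_himp, Hoop.himp_self, himp_one]

theorem le_trans {a b c : α} (h1 : le a b) (h2 : le b c) : le a c := by
  have h : a = mul c (mul (himp c b) (himp b a)) := by
    rw [← Hoop.mul_assoc, mul_eq_of_le h2, mul_eq_of_le h1]
  rw [h]; exact mul_le_left _ _

theorem mul_le_right (a b : α) : le (mul a b) b := by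
  rw [Hoop.mul_comm]; exact mul_le_left _ _

theorem mul_mono_left {a b : α} (c : α) (h : le a b) : le (mul a c) (mul b c) :=
  adj.2 (le_trans h (adj.1 (le_refl _)))

theorem mul_mono_right {a b : α} (c : α) (h : le a b) : le (mul c a) (mul c b) := by
  rw [Hoop.mul_comm c a, Hoop.mul_comm c b]; exact mul_mono_left c h

theorem mp (a b : α) : le (mul (himp a b) a) b := adj.2 (le_refl _)

theorem le_himp (a b : α) : le b (himp a b) := adj.1 (mul_le_left _ _)

theorem himp_mono {a b : α} (c : α) (h : le a b) : le (himp c a) (himp c b) :=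
  adj.1 (le_trans (mp _ _) h)

theorem himp_anti {a b : α} (c : α) (h : le a b) : le (himp b c) (himp a c) :=
  adj.1 (le_trans (mul_mono_right _ h) (mp _ _))

theorem himp_swap (a b c : α) : himp a (himp b c) = himp b (himp a c) := by
  rw [Hoop.himp_himp, Hoop.mul_comm, ← Hoop.himp_himp]

/-- The key identity for `f`-closed elements. -/
theorem key {f a b : α} (ha : himp f a = a) (hb : himp f b = b) :
    himp f (mul a b) = mul a b := by
  obtain ⟨c, hc⟩ : ∃ c, himp f (mul a b) = c := ⟨_, rfl⟩
  have hpc : le (mul a b) c := hc ▸ le_himp _ _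
  have hca : le c a := by
    have := himp_mono f (mul_le_left a b); rwa [hc, ha] at this
  have hcb : le c b := by
    have := himp_mono f (mul_le_right a b); rwa [hc, hb] at this
  obtain ⟨d, hd⟩ : ∃ d, himp a c = d := ⟨_, rfl⟩
  obtain ⟨w, hw⟩ : ∃ w, himp d b = w := ⟨_, rfl⟩
  obtain ⟨u, hu⟩ : ∃ u, himp c (mul a b) = u := ⟨_, rfl⟩
  have hbd : le b d := by
    rw [← hd]; apply adj.1; rw [Hoop.mul_comm]; exact hpc
  have hdw : mul d w = b := by rw [← hw]; exact mul_eq_of_le hbd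
  have had : mul a d = c := by rw [← hd]; exact mul_eq_of_le hca
  have hcw : mul c w = mul a b := by rw [← had, Hoop.mul_assoc, hdw]
  have hcu : mul c u = mul a b := by rw [← hu]; exact mul_eq_of_le hpc
  have hfw : himp f w = w := by rw [← hw, himp_swap, hb]
  have hfu : le f u := by
    unfold le; rw [← hu, himp_swap, hc, Hoop.himp_self]
  have hwu : le w u := by
    rw [← hu]; apply adj.1; rw [Hoop.mul_comm, hcw]; exact le_refl _
  have huw : himp u w = w := by
    refine le_antisymm ?_ (le_himp _ _)
    have := himp_anti w hfu; rwa [hfw] at this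
  have huw2 : mul u w = w := by
    have := mul_eq_of_le hwu; rwa [huw] at this
  have hcw' : le c w := le_trans hcb (hw ▸ le_himp _ _)
  have e : mul w (himp w c) = c := mul_eq_of_le hcw'
  rw [hc, ← hcu]
  calc c = mul (mul u w) (himp w c) := by rw [huw2, e]
    _ = mul c u := by rw [Hoop.mul_assoc, e, Hoop.mul_comm]

theorem himp_mul {f : α} (hf : mul f f = f) (x y : α) :
    himp f (mul x y) = mul (himp f x) (himp f y) := by
  have h := key (f := f) (a := himp f x) (b := himp f y)
    (by rw [Hoop.himp_himp, hf]) (by rw [Hoop.himp_himp, hf])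
  refine le_antisymm ?_ ?_
  · rw [← h]
    exact himp_mono f (le_trans (mul_mono_left _ (le_himp _ _)) (mul_mono_right _ (le_himp _ _)))
  · apply adj.1
    have e : mul (mul (himp f x) (himp f y)) f
        = mul (mul (himp f x) f) (mul (himp f y) f) := by
      rw [Hoop.mul_assoc (himp f x) f, Hoop.mul_comm f, Hoop.mul_assoc (himp f y) f f, hf,
        Hoop.mul_assoc]
    rw [e]
    exact le_trans (mul_mono_left _ (mp _ _)) (mul_mono_right _ (mp _ _))

theorem himp_himp_dist {f : α} (hf : mul f f = f) (x y : α) :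
    himp f (himp x y) = himp (himp f x) (himp f y) := by
  refine le_antisymm ?_ ?_
  · apply adj.1; apply adj.1
    have e : mul (mul (himp f (himp x y)) (himp f x)) f
        = mul (mul (himp f (himp x y)) f) (mul (himp f x) f) := by
      rw [Hoop.mul_assoc _ f, Hoop.mul_comm f, Hoop.mul_assoc (himp f x) f f, hf,
        Hoop.mul_assoc]
    rw [e]
    exact le_trans (mul_mono_left _ (mp _ _))
      (le_trans (mul_mono_right _ (mp _ _)) (mp _ _))
  · rw [himp_swap f x y]
    exact himp_anti _ (le_himp _ _)

theorem exists_min [Finite α] (P : α → Prop) (h1 : P one)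
    (hm : ∀ a b, P a → P b → P (mul a b)) : ∃ f, P f ∧ ∀ x, P x → le f x := by
  classical
  cases nonempty_fintype α
  have : ∀ S : Finset α, ∃ f, P f ∧ ∀ x ∈ S, P x → le f x := by
    intro S
    induction S using Finset.induction_on with
    | empty => exact ⟨one, h1, by simp⟩
    | insert a S _ ih =>
      obtain ⟨f, hf, hS⟩ := ih
      by_cases ha : P a
      · refine ⟨mul a f, hm _ _ ha hf, ?_⟩
        intro x hx hPx
        rcases Finset.mem_insert.1 hx with rfl | hx
        · exact mul_le_left _ _
        · exact le_trans (mul_le_right _ _) (hS x hx hPx)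
      · refine ⟨f, hf, ?_⟩
        intro x hx hPx
        rcases Finset.mem_insert.1 hx with rfl | hx
        · exact absurd hPx ha
        · exact hS x hx hPx
  obtain ⟨f, hf, h⟩ := this Finset.univ
  exact ⟨f, hf, fun x hx => h x (Finset.mem_univ x) hx⟩

theorem retract (A B : Type) [BHoop A] [BHoop B] [Finite B] (g : B → A)
    (hg : IsBHoopHom g) (hgsurj : Function.Surjective g)
    (hg0 : ∀ x : B, g x = BHoop.zero → x = BHoop.zero) :
    ∃ h : A → B, IsBHoopHom h ∧ g ∘ h = id := by
  obtain ⟨gm, gi, g1, g0⟩ := hg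
  obtain ⟨f, hf1, hmin⟩ := exists_min (fun x : B => g x = one) g1
    (fun a b ha hb => by rw [gm, ha, hb, Hoop.mul_one])
  have hff : mul f f = f :=
    le_antisymm (mul_le_left _ _) (hmin _ (by rw [gm, hf1, Hoop.mul_one]))
  have wd1 : ∀ x y : B, g x = g y → le (himp f x) (himp f y) := by
    intro x y hxy
    have h : le f (himp x y) := hmin _ (by rw [gi, hxy, Hoop.himp_self])
    unfold le
    rw [← himp_himp_dist hff]
    exact h
  have wd : ∀ x y : B, g x = g y → himp f x = himp f y := fun x y h =>
    le_antisymm (wd1 x y h) (wd1 y x h.symm)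
  choose s hs using hgsurj
  have gh : ∀ x, g (himp f (s x)) = x := by
    intro x; rw [gi, hf1, one_himp, hs]
  refine ⟨fun a => himp f (s a), ⟨?_, ?_, ?_, ?_⟩, funext gh⟩
  · intro a b
    rw [← himp_mul hff]
    exact wd _ _ (by rw [gm, hs, hs, hs])
  · intro a b
    rw [← himp_himp_dist hff]
    exact wd _ _ (by rw [gi, hs, hs, hs])
  · change himp f (s one) = one
    rw [wd (s one) one (by rw [hs, g1]), himp_one]
  · exact hg0 _ (gh _)

end HoopAux

/-- Any finite bounded hoop `A` is a retract of any finite bounded hoop `B` of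
which it is a homomorphic image via a zero-reflecting map; consequently, every
finite bounded hoop is zero-projective in the class of all finite bounded
hoops. -/
theorem finite_bounded_hoop_retract_and_zero_projective (A B : Type)
    [BHoop A] [BHoop B] [Finite A] [Finite B] (g : B → A) (hg : IsBHoopHom g)
    (hgsurj : Function.Surjective g)
    (hg0 : ∀ x : B, g x = BHoop.zero → x = BHoop.zero) :
    (∃ h : A → B, IsBHoopHom h ∧ g ∘ h = id) ∧
    (∀ (A' : Type) [BHoop A'] [Finite A'],
      ∀ (B' C' : Type) [BHoop B'] [BHoop C'] [Finite B'] [Finite C'],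
        ∀ (h : A' → C') (g' : B' → C'), IsBHoopHom h → IsBHoopHom g' →
          Function.Surjective g' →
          (∀ x : B', g' x = BHoop.zero → x = BHoop.zero) →
            ∃ f : A' → B', IsBHoopHom f ∧ g' ∘ f = h) := by
  refine ⟨HoopAux.retract A B g hg hgsurj hg0, ?_⟩
  intro A' _ _ B' C' _ _ _ _ h g' hh hg' hs h0
  obtain ⟨k, ⟨km, ki, k1, k0⟩, hk⟩ := HoopAux.retract C' B' g' hg' hs h0
  obtain ⟨hm, hi, h1, hz⟩ := hh
  refine ⟨k ∘ h, ⟨?_, ?_, ?_, ?_⟩, ?_⟩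
  · intro a b; simp only [Function.comp, hm, km]
  · intro a b; simp only [Function.comp, hi, ki]
  · simp only [Function.comp, h1, k1]
  · simp only [Function.comp, hz, k0]
  · rw [← Function.comp_assoc, hk, Function.id_comp]
end

section
/- Let A be a bounded hoop and u ∈ A with u·u = u. Then for all a, b ∈ A: (U1) u·a = u·(u → a) (i.e., u·a is the meet u ∧ a); (U2) u → (u·a) = u → a; (U3) ¬¬u·((u → a) → (u → b)) = (u → a) → (¬¬u·(u → b)); (U4) (u → a) → (u → b) = (¬¬u·(u → a)) → (¬¬u·(u → b)) = (¬¬u·(u → a)) → (u → b). -/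
namespace HoopAux
open Hoop (mul himp one)

variable {A : Type}

theorem one_mul_s15 [Hoop A] (x : A) : mul one x = x := by rw [Hoop.mul_comm, Hoop.mul_one]

theorem antisymm [Hoop A] {x y : A} (h : himp x y = one) (k : himp y x = one) : x = y := by
  have := Hoop.div x y
  rwa [h, k, Hoop.mul_one, Hoop.mul_one] at this

theorem one_himp_s15 [Hoop A] (x : A) : himp one x = x := by
  have h1 : ∀ q : A, himp one q = q → himp q one = one := by
    intro q hq
    have h := Hoop.div q one
    rw [HoopAux.one_mul_s15, hq] at h
    have h2 := Hoop.himp_himp (himp q one) q (one : A)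
    rw [Hoop.mul_comm, h, Hoop.himp_self] at h2
    exact h2.symm
  have hq : himp one (himp x one) = himp x (one : A) := by rw [Hoop.himp_himp, HoopAux.one_mul_s15]
  apply antisymm
  · have h := Hoop.div one x
    rw [HoopAux.one_mul_s15] at h
    rw [h, Hoop.mul_comm, ← Hoop.himp_himp, Hoop.himp_self]
    exact h1 _ hq
  · rw [Hoop.himp_himp, Hoop.mul_one, Hoop.himp_self]

theorem himp_one_s15 [Hoop A] (x : A) : himp x one = one := by
  have h := Hoop.div x one
  rw [HoopAux.one_mul_s15, one_himp_s15] at h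
  have h2 := Hoop.himp_himp (himp x one) x (one : A)
  rw [Hoop.mul_comm, h, Hoop.himp_self] at h2
  exact h2.symm

theorem trans [Hoop A] {x y z : A} (h : himp x y = one) (k : himp y z = one) :
    himp x z = one := by
  have e := Hoop.div x y
  rw [h, Hoop.mul_one] at e
  rw [e, Hoop.mul_comm, ← Hoop.himp_himp, k, HoopAux.himp_one_s15]

/-- `x·y ≤ z` from `x ≤ y → z`. -/
theorem res [Hoop A] (x y z : A) : himp (mul x y) z = one ↔ himp x (himp y z) = one := by
  rw [Hoop.himp_himp]

theorem mul_le_left_s15 [Hoop A] (x y : A) : himp (mul x y) x = one := by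
  rw [Hoop.mul_comm, ← Hoop.himp_himp, Hoop.himp_self, HoopAux.himp_one_s15]

theorem mul_le_right_s15 [Hoop A] (x y : A) : himp (mul x y) y = one := by
  rw [← Hoop.himp_himp, Hoop.himp_self, HoopAux.himp_one_s15]

theorem mul_mono [Hoop A] {x y : A} (z : A) (h : himp x y = one) :
    himp (mul z x) (mul z y) = one := by
  rw [Hoop.mul_comm z x, res]
  apply trans h
  rw [← res, Hoop.mul_comm, Hoop.himp_self]

theorem mp_le [Hoop A] (x y : A) : himp (mul x (himp x y)) y = one := by
  rw [Hoop.mul_comm, res, Hoop.himp_self]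

theorem himp_mono_s15 [Hoop A] {x y : A} (z : A) (h : himp x y = one) :
    himp (himp z x) (himp z y) = one := by
  rw [← res, Hoop.mul_comm]
  exact trans (mp_le z x) h

theorem himp_anti_s15 [Hoop A] {x y : A} (z : A) (h : himp x y = one) :
    himp (himp y z) (himp x z) = one := by
  rw [← res]
  exact trans (mul_mono _ h) (by rw [Hoop.mul_comm]; exact mp_le y z)

theorem le_himp_s15 [Hoop A] (x y : A) : himp x (himp y x) = one := by
  rw [← res]; exact mul_le_left_s15 x y

theorem swap [Hoop A] (x y z : A) : himp x (himp y z) = himp y (himp x z) := by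
  rw [Hoop.himp_himp, Hoop.himp_himp, Hoop.mul_comm]

/-- a common lower bound of `x`, `y` is below `x·(x → y)`. -/
theorem le_meet [Hoop A] {x y z : A} (h : himp z x = one) (k : himp z y = one) :
    himp z (mul x (himp x y)) = one := by
  have e := Hoop.div z x
  rw [h, Hoop.mul_one] at e
  have h2 : himp (mul x (himp x z)) (mul x (himp x y)) = one := mul_mono x (himp_mono_s15 x k)
  rwa [← e] at h2

theorem U1 [Hoop A] {u : A} (hu : mul u u = u) (a : A) : mul u a = mul u (himp u a) := by
  apply antisymm
  · exact mul_mono u (le_himp_s15 a u)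
  · have h : himp (mul u (mul u (himp u a))) (mul u a) = one := mul_mono u (mp_le u a)
    rwa [← Hoop.mul_assoc, hu] at h

theorem mul_eq_of_le_s15 [Hoop A] {u a : A} (hu : mul u u = u) (h : himp u a = one) :
    mul u a = u := by
  rw [U1 hu, h, Hoop.mul_one]

theorem le_nn [BHoop A] (u : A) : himp u (BHoop.neg (BHoop.neg u)) = one := by
  unfold BHoop.neg
  rw [swap, Hoop.himp_self]

theorem eq_zero [BHoop A] {x : A} (h : himp x BHoop.zero = one) : x = BHoop.zero :=
  antisymm h (BHoop.zero_himp x)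

/-- `¬¬u ∧ ¬u = 0`. -/
theorem meet_zero [BHoop A] {u : A} (hu : mul u u = u) :
    mul (BHoop.neg (BHoop.neg u)) (himp (BHoop.neg (BHoop.neg u)) (BHoop.neg u)) =
      BHoop.zero := by
  have h : himp (BHoop.neg (BHoop.neg u)) (BHoop.neg u) = BHoop.neg u := by
    have h3 : himp (BHoop.neg (BHoop.neg u)) BHoop.zero = BHoop.neg u := by
      apply antisymm
      · exact himp_anti_s15 _ (le_nn u)
      · exact le_nn (BHoop.neg u)
    calc himp (BHoop.neg (BHoop.neg u)) (BHoop.neg u)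
        = himp u (himp (BHoop.neg (BHoop.neg u)) BHoop.zero) := swap _ _ _
      _ = himp u (himp u BHoop.zero) := by rw [h3]; rfl
      _ = BHoop.neg u := by rw [Hoop.himp_himp, hu]; rfl
  rw [h]
  apply eq_zero
  rw [Hoop.mul_comm]
  exact mp_le (BHoop.neg u) BHoop.zero

/-- The double negation of an idempotent is idempotent. -/
theorem nn_idem [BHoop A] {u : A} (hu : mul u u = u) :
    mul (BHoop.neg (BHoop.neg u)) (BHoop.neg (BHoop.neg u)) = BHoop.neg (BHoop.neg u) := by
  have m := meet_zero hu
  have huv := le_nn u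
  have hdef : BHoop.neg (BHoop.neg u) = himp (BHoop.neg u) BHoop.zero := rfl
  have hwv := le_nn (BHoop.neg u)
  generalize hV : BHoop.neg (BHoop.neg u) = v at *
  have hve : himp v (himp v (mul v v)) = one := by rw [Hoop.himp_himp, Hoop.himp_self]
  have hwe : himp (BHoop.neg u) (himp v (mul v v)) = one :=
    trans hwv (himp_mono_s15 v (BHoop.zero_himp _))
  have hn : himp (himp v (mul v v)) BHoop.zero = BHoop.zero := by
    apply eq_zero
    have a1 : himp (himp (himp v (mul v v)) BHoop.zero) v = one := by
      have := himp_anti_s15 BHoop.zero hwe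
      rwa [← hdef] at this
    have a2 : himp (himp (himp v (mul v v)) BHoop.zero) (BHoop.neg u) = one :=
      himp_anti_s15 BHoop.zero (trans huv hve)
    have := le_meet a1 a2
    rwa [m] at this
  have hev : himp (himp v (mul v v)) v = v := by
    conv_lhs => rw [hdef, swap]
    rw [← hdef, hn, ← hdef]
  have d := Hoop.div v (himp v (mul v v))
  rw [hve, hev, Hoop.mul_one] at d
  apply antisymm (mul_le_left_s15 v v)
  have h := mp_le v (mul v v)
  rw [Hoop.mul_comm, ← d] at h
  exact h

end HoopAux

/-- Properties (U1)–(U4) of an idempotent element `u` of a bounded hoop. -/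
theorem bounded_hoop_idempotent_U1_U4 (A : Type) [BHoop A] (u : A)
    (hu : Hoop.mul u u = u) (a b : A) :
    Hoop.mul u a = Hoop.mul u (Hoop.himp u a) ∧
    Hoop.himp u (Hoop.mul u a) = Hoop.himp u a ∧
    Hoop.mul (BHoop.neg (BHoop.neg u)) (Hoop.himp (Hoop.himp u a) (Hoop.himp u b)) =
      Hoop.himp (Hoop.himp u a) (Hoop.mul (BHoop.neg (BHoop.neg u)) (Hoop.himp u b)) ∧
    Hoop.himp (Hoop.himp u a) (Hoop.himp u b) =
      Hoop.himp (Hoop.mul (BHoop.neg (BHoop.neg u)) (Hoop.himp u a))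
        (Hoop.mul (BHoop.neg (BHoop.neg u)) (Hoop.himp u b)) ∧
    Hoop.himp (Hoop.himp u a) (Hoop.himp u b) =
      Hoop.himp (Hoop.mul (BHoop.neg (BHoop.neg u)) (Hoop.himp u a))
        (Hoop.himp u b) := by
  have hv := HoopAux.nn_idem hu
  have huv := HoopAux.mul_eq_of_le_s15 hu (HoopAux.le_nn u)
  have m := HoopAux.meet_zero hu
  have key : Hoop.himp (Hoop.himp (BHoop.neg u) (BHoop.neg (BHoop.neg u)))
      (BHoop.neg (BHoop.neg u)) = Hoop.one := by
    refine (HoopAux.res _ (BHoop.neg u) BHoop.zero).mp ?_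
    rw [Hoop.mul_comm, Hoop.div, m, Hoop.himp_self]
  have hx : Hoop.himp (BHoop.neg u) (Hoop.himp u a) = Hoop.one :=
    HoopAux.himp_mono_s15 u (BHoop.zero_himp a)
  generalize BHoop.neg (BHoop.neg u) = v at *
  have h5 : Hoop.himp (Hoop.himp u a) (Hoop.himp u b) =
      Hoop.himp (Hoop.mul v (Hoop.himp u a)) (Hoop.himp u b) := by
    rw [HoopAux.swap, HoopAux.swap (Hoop.mul v _), ← Hoop.himp_himp v, HoopAux.swap u v,
      Hoop.himp_himp v u, Hoop.mul_comm v u, huv]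
  refine ⟨HoopAux.U1 hu a, ?_, ?_, ?_, h5⟩
  · apply HoopAux.antisymm
    · exact HoopAux.himp_mono_s15 u (HoopAux.mul_le_right_s15 u a)
    · rw [← HoopAux.res, HoopAux.U1 hu a, Hoop.mul_comm, Hoop.himp_self]
  · apply HoopAux.antisymm
    · rw [← HoopAux.res, Hoop.mul_assoc]
      apply HoopAux.mul_mono
      rw [Hoop.mul_comm]
      exact HoopAux.mp_le _ _
    · rw [HoopAux.U1 hv (Hoop.himp (Hoop.himp u a) (Hoop.himp u b))]
      apply HoopAux.le_meet
      · exact HoopAux.trans (HoopAux.himp_mono_s15 _ (HoopAux.mul_le_left_s15 _ _))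
          (HoopAux.trans (HoopAux.himp_anti_s15 _ hx) key)
      · exact HoopAux.himp_mono_s15 _ (HoopAux.mul_le_right_s15 _ _)
  · apply HoopAux.antisymm
    · rw [← HoopAux.res, Hoop.mul_comm, Hoop.mul_assoc]
      exact HoopAux.mul_mono _ (HoopAux.mp_le _ _)
    · rw [h5]
      exact HoopAux.himp_mono_s15 _ (HoopAux.mul_le_right_s15 _ _)
end
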